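/- The trace ideal tr(ω) of the Hibi ring R(P) equals the whole ring R(P) (i.e. the non-Gorenstein locus of Spec R(P) is empty) if and only if the bounded poset P̄ is graded. -/

import Mathlib

noncomputable section

/-- `ψ : Q → ℤ` is a grading of the poset `Q`: it drops by exactly one along every covering
relation (functions here are order-reversing, matching the conventions for Hibi rings). -/
def IsGrading (Q : Type*) [PartialOrder Q] (ψ : Q → ℤ) : Prop :=
  ∀ a b : Q, a ⋖ b → ψ a = ψ b + 1

/-- a poset is graded if it admits a grading -/
def IsGradedPoset (Q : Type*) [PartialOrder Q] : Prop :=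
  ∃ ψ : Q → ℤ, IsGrading Q ψ

/-- a subset `A` of a poset is connected: any two of its elements are joined by a finite
sequence inside `A` in which consecutive elements are comparable -/
def ConnSubset {Q : Type*} [PartialOrder Q] (A : Set Q) : Prop :=
  ∀ x ∈ A, ∀ y ∈ A,
    Relation.ReflTransGen (fun p q : Q => p ∈ A ∧ q ∈ A ∧ (p ≤ q ∨ q ≤ p)) x y

/-- a subset `A` of a poset is order-convex: `a ≤ b ≤ c` with `a, c ∈ A` implies `b ∈ A` -/
def OrderConvex {Q : Type*} [PartialOrder Q] (A : Set Q) : Prop :=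
  ∀ a b c : Q, a ≤ b → b ≤ c → a ∈ A → c ∈ A → b ∈ A

/-- a complete subset: nonempty, connected and order-convex (exactly the subsets occurring as
fibres of quotient poset maps) -/
def CompleteSubset {Q : Type*} [PartialOrder Q] (A : Set Q) : Prop :=
  A.Nonempty ∧ ConnSubset A ∧ OrderConvex A

/-- `φ : Q → Q'` is a quotient poset map: surjective, order preserving, with connected fibres,
such that the order on `Q'` is the transitive closure of the relation
`a' ≤ b' ↔ ∃ a ∈ φ⁻¹(a'), b ∈ φ⁻¹(b'), a ≤ b`. -/
def IsQuotientPosetMap {Q Q' : Type*} [PartialOrder Q] [PartialOrder Q']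
    (φ : Q → Q') : Prop :=
  Function.Surjective φ ∧ Monotone φ ∧ (∀ q' : Q', ConnSubset (φ ⁻¹' {q'})) ∧
    ∀ a' b' : Q', a' ≤ b' ↔
      Relation.TransGen (fun x' y' : Q' => ∃ a b : Q, φ a = x' ∧ φ b = y' ∧ a ≤ b) a' b'


set_option synthInstance.maxHeartbeats 1000000
set_option maxHeartbeats 1000000

/-- `P̄ = P ∪ {-∞, ∞}`: the poset `P` with a new minimum and a new maximum adjoined -/
abbrev Pbar (P : Type) [PartialOrder P] : Type := WithBot (WithTop P)

variable (k : Type) [Field k] (P : Type) [Fintype P] [PartialOrder P]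

/-- the monomial `χ^ψ` in the Laurent polynomial ring -/
def hibiMono (ψ : Pbar P → ℤ) : AddMonoidAlgebra k (Pbar P → ℤ) :=
  AddMonoidAlgebra.single ψ 1

/-- a lattice point of the cone `C(P)`: an order-reversing integral function on `P̄`
with `ψ(∞) = 0` -/
def InConeP (ψ : Pbar P → ℤ) : Prop := Antitone ψ ∧ ψ ⊤ = 0

/-- the Hibi ring `R(P) = k[C(P) ∩ ℤ^{P ∪ {-∞}}]`, the subalgebra of the Laurent polynomial
ring spanned by the monomials `χ^ψ` with `ψ` an integral point of `C(P)` -/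
def hibiRing : Subalgebra k (AddMonoidAlgebra k (Pbar P → ℤ)) :=
  Algebra.adjoin k {f | ∃ ψ : Pbar P → ℤ, InConeP P ψ ∧ f = hibiMono k P ψ}

/-- the canonical module `ω` of the Hibi ring: spanned by the monomials `χ^ψ` with `ψ`
integral, `ψ(∞) = 0` and `ψ a ≥ ψ b + 1` for every covering relation `a ⋖ b` of `P̄` -/
def hibiOmega : Submodule ↥(hibiRing k P) (AddMonoidAlgebra k (Pbar P → ℤ)) :=
  Submodule.span ↥(hibiRing k P)
    {f | ∃ ψ : Pbar P → ℤ, ψ ⊤ = 0 ∧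
      (∀ a b : Pbar P, a ⋖ b → ψ b + 1 ≤ ψ a) ∧ f = hibiMono k P ψ}

/-- the trace ideal `tr(ω)` of the canonical module of the Hibi ring -/
def hibiTrace : Ideal ↥(hibiRing k P) :=
  Ideal.span {r | ∃ (φ : ↥(hibiOmega k P) →ₗ[↥(hibiRing k P)] ↥(hibiRing k P))
    (x : ↥(hibiOmega k P)), φ x = r}

end

section Poset

variable {Q : Type*} [PartialOrder Q] [Finite Q]

/-- In a finite poset every covering relation is realised with a jump of exactly one by some
strictly order-reversing integral function. -/
theorem CovBy.exists_strictAnti_eq_add_one {a b : Q} (hab : a ⋖ b) :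
    ∃ ψ : Q → ℤ, StrictAnti ψ ∧ ψ a = ψ b + 1 := by
  classical
  have := Fintype.ofFinite Q
  let g : Q → ℤ := fun x => (Finset.univ.filter (x < ·)).card
  have hg : StrictAnti g := fun x y hxy => by
    refine Int.ofNat_lt.2 (Finset.card_lt_card (Finset.ssubset_iff_of_subset ?_ |>.2 ?_))
    · intro z hz
      simp only [Finset.mem_filter, Finset.mem_univ, true_and] at hz ⊢
      exact hxy.trans hz
    · exact ⟨y, by simpa using hxy, by simp⟩
  have hg_nonneg : ∀ x, 0 ≤ g x := fun x => Int.natCast_nonneg _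
  have hg_le : ∀ x, g x ≤ Fintype.card Q := fun x => Int.ofNat_le.2 (Finset.card_le_univ _)
  have hne : a ≠ b := hab.lt.ne
  refine ⟨fun x => if x = a then 1 else if x = b then 0 else
    if x < b then g x + 2 else g x - (Fintype.card Q + 1), fun x y hxy => ?_, ?_⟩
  · have hxy' := hg hxy
    have hx := hg_nonneg x
    have hy := hg_le y
    have hx_le := hg_le x
    have hy_nonneg := hg_nonneg y
    have hbet : a < y → ¬ y < b := fun h => hab.2 h
    have htrans : y < b → x < b := hxy.trans
    have hasymm : x < y → ¬ y < x := fun h => h.asymm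
    have hirrefl : ¬ x < x := lt_irrefl x
    have hab' := hab.lt
    have hxb : y = a → x < b := fun h => hxy.trans (h ▸ hab')
    dsimp only
    split_ifs <;> subst_vars <;> first | omega | (exfalso; grind)
  · simp [hne.symm]

theorem antitone_of_forall_covBy {f : Q → ℤ} (hf : ∀ a b : Q, a ⋖ b → f b ≤ f a) :
    Antitone f := by
  classical
  have := Fintype.ofFinite Q
  let := Fintype.toLocallyFiniteOrder (α := Q)
  exact (antitone_iff_forall_covBy f).2 hf

end Poset

section Hibi

variable {k : Type} [Field k] {P : Type} [PartialOrder P]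

theorem InConeP.zero : InConeP P 0 := ⟨fun _ _ _ => le_rfl, rfl⟩

theorem InConeP.add {ψ ψ' : Pbar P → ℤ} (h : InConeP P ψ) (h' : InConeP P ψ') :
    InConeP P (ψ + ψ') :=
  ⟨h.1.add h'.1, by simp [h.2, h'.2]⟩

theorem InConeP.nonneg {ψ : Pbar P → ℤ} (h : InConeP P ψ) : 0 ≤ ψ := fun _ =>
  h.2.symm.le.trans (h.1 le_top)

theorem hibiMono_mem_hibiRing {ψ : Pbar P → ℤ} (h : InConeP P ψ) :
    hibiMono k P ψ ∈ hibiRing k P :=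
  Algebra.subset_adjoin ⟨ψ, h, rfl⟩

theorem exists_add_eq_of_coeff_mul_ne_zero {f g : AddMonoidAlgebra k (Pbar P → ℤ)}
    {ψ : Pbar P → ℤ} (h : (f * g).coeff ψ ≠ 0) :
    ∃ a b, f.coeff a ≠ 0 ∧ g.coeff b ≠ 0 ∧ a + b = ψ := by
  classical
  obtain ⟨a, ha, b, hb, hab⟩ := Finset.mem_add.1
    (AddMonoidAlgebra.support_coeff_mul_subset f g (Finsupp.mem_support_iff.2 h))
  exact ⟨a, b, Finsupp.mem_support_iff.1 ha, Finsupp.mem_support_iff.1 hb, hab⟩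

/-- The Hibi ring is supported on the lattice points of the cone. -/
theorem inConeP_of_coeff_ne_zero {f : AddMonoidAlgebra k (Pbar P → ℤ)} (hf : f ∈ hibiRing k P) :
    ∀ ψ, f.coeff ψ ≠ 0 → InConeP P ψ := by
  classical
  induction hf using Algebra.adjoin_induction with
  | mem x hx =>
    obtain ⟨ψ', h, rfl⟩ := hx
    intro ψ hψ
    by_cases e : ψ' = ψ
    · exact e ▸ h
    · simp [hibiMono, e] at hψ
  | algebraMap r =>
    intro ψ hψ
    by_cases e : ψ = 0
    · exact e ▸ InConeP.zero
    · simp [Ne.symm e] at hψ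
  | add x y _ _ hx hy =>
    intro ψ hψ
    by_cases e : x.coeff ψ = 0
    · exact hy ψ fun e' => hψ (by simp [e, e'])
    · exact hx ψ e
  | mul x y _ _ hx hy =>
    intro ψ hψ
    obtain ⟨a, b, ha, hb, rfl⟩ := exists_add_eq_of_coeff_mul_ne_zero hψ
    exact (hx a ha).add (hy b hb)

theorem coeff_mul_zero_eq_zero {f g : AddMonoidAlgebra k (Pbar P → ℤ)} (hf : f ∈ hibiRing k P)
    (hg : g ∈ hibiRing k P) (h : g.coeff 0 = 0) : (f * g).coeff 0 = 0 := by
  by_contra hne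
  obtain ⟨a, b, ha, hb, hab⟩ := exists_add_eq_of_coeff_mul_ne_zero hne
  have ha' := (inConeP_of_coeff_ne_zero hf a ha).nonneg
  have hb' := (inConeP_of_coeff_ne_zero hg b hb).nonneg
  have : b = 0 := (add_eq_zero_iff_of_nonneg ha' hb').1 hab |>.2
  exact hb (this ▸ h)

/-- If the trace is everything then some homomorphism sends some monomial of `ω` to an element
with nonzero constant coefficient. -/
theorem exists_coeff_zero_ne_zero_of_hibiTrace_eq_top (h : hibiTrace k P = ⊤) :
    ∃ (φ : ↥(hibiOmega k P) →ₗ[↥(hibiRing k P)] ↥(hibiRing k P)) (x : ↥(hibiOmega k P))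
      (ψ : Pbar P → ℤ), ψ ⊤ = 0 ∧ (∀ a b : Pbar P, a ⋖ b → ψ b + 1 ≤ ψ a) ∧
        (x : AddMonoidAlgebra k (Pbar P → ℤ)) = hibiMono k P ψ ∧
        (φ x : AddMonoidAlgebra k (Pbar P → ℤ)).coeff 0 ≠ 0 := by
  by_contra! hcon
  have hzero : ∀ (φ : ↥(hibiOmega k P) →ₗ[↥(hibiRing k P)] ↥(hibiRing k P))
      (x : AddMonoidAlgebra k (Pbar P → ℤ)) (hx : x ∈ hibiOmega k P),
      (φ ⟨x, hx⟩ : AddMonoidAlgebra k (Pbar P → ℤ)).coeff 0 = 0 := by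
    intro φ x hx
    induction hx using Submodule.span_induction with
    | mem x hx =>
      obtain ⟨ψ, h0, h1, rfl⟩ := hx
      exact hcon φ _ ψ h0 h1 rfl
    | zero =>
      have : φ ⟨0, Submodule.zero_mem _⟩ = 0 := φ.map_zero
      rw [this]
      simp
    | add x y hx hy ihx ihy =>
      have : φ ⟨x + y, Submodule.add_mem _ hx hy⟩ = φ ⟨x, hx⟩ + φ ⟨y, hy⟩ :=
        φ.map_add ⟨x, hx⟩ ⟨y, hy⟩
      rw [this]
      simp [ihx, ihy]
    | smul r x hx ih =>
      have : φ ⟨r • x, Submodule.smul_mem _ r hx⟩ = r * φ ⟨x, hx⟩ := φ.map_smul r ⟨x, hx⟩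
      rw [this]
      exact coeff_mul_zero_eq_zero r.2 (φ ⟨x, hx⟩).2 ih
  have hall : ∀ r ∈ hibiTrace k P, (r : AddMonoidAlgebra k (Pbar P → ℤ)).coeff 0 = 0 := by
    intro r hr
    induction hr using Submodule.span_induction with
    | mem r hr =>
      obtain ⟨φ, x, rfl⟩ := hr
      exact hzero φ x.1 x.2
    | zero => simp
    | add x y _ _ hx hy => simp [hx, hy]
    | smul r x _ hx => exact coeff_mul_zero_eq_zero r.2 x.2 hx
  have := hall 1 (h ▸ Submodule.mem_top)
  simp at this

variable [Fintype P]

theorem isGradedPoset_of_hibiTrace_eq_top (h : hibiTrace k P = ⊤) : IsGradedPoset (Pbar P) := by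
  classical
  obtain ⟨φ, x, ψ, hψ0, hψ1, hx, hφ⟩ := exists_coeff_zero_ne_zero_of_hibiTrace_eq_top h
  refine ⟨ψ, fun a b hab => le_antisymm ?_ (hψ1 a b hab)⟩
  obtain ⟨ρ, hρ, hρab⟩ := hab.exists_strictAnti_eq_add_one
  let ψ' : Pbar P → ℤ := fun c => ρ c - ρ ⊤
  have hψ' : StrictAnti ψ' := fun c d hcd => sub_lt_sub_right (hρ hcd) _
  have hmem {χ : Pbar P → ℤ} (h0 : χ ⊤ = 0) (h1 : ∀ a b : Pbar P, a ⋖ b → χ b + 1 ≤ χ a) :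
      hibiMono k P χ ∈ hibiRing k P :=
    hibiMono_mem_hibiRing ⟨antitone_of_forall_covBy fun c d hcd => by linarith [h1 c d hcd], h0⟩
  have h0' : ψ' ⊤ = 0 := sub_self _
  have h1' : ∀ a b : Pbar P, a ⋖ b → ψ' b + 1 ≤ ψ' a := fun c d hcd =>
    Int.add_one_le_of_lt (hψ' hcd.lt)
  let y : hibiOmega k P := ⟨hibiMono k P ψ', Submodule.subset_span ⟨ψ', h0', h1', rfl⟩⟩
  let r : hibiRing k P := ⟨hibiMono k P ψ, hmem hψ0 hψ1⟩
  let r' : hibiRing k P := ⟨hibiMono k P ψ', hmem h0' h1'⟩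
  have hsmul : r • y = r' • x := Subtype.ext <| by
    change hibiMono k P ψ * hibiMono k P ψ' = hibiMono k P ψ' * (x : AddMonoidAlgebra k _)
    rw [hx, mul_comm]
  have key : r * φ y = r' * φ x := by
    rw [← smul_eq_mul, ← smul_eq_mul, ← map_smul, ← map_smul, hsmul]
  have key' : hibiMono k P ψ * (φ y : AddMonoidAlgebra k (Pbar P → ℤ)) =
      hibiMono k P ψ' * (φ x : AddMonoidAlgebra k (Pbar P → ℤ)) := congrArg Subtype.val key
  have hne : (φ y : AddMonoidAlgebra k (Pbar P → ℤ)).coeff (-ψ + ψ') ≠ 0 := by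
    have := congrArg (fun f => f.coeff ψ') key'
    simp only [hibiMono, AddMonoidAlgebra.coeff_single_mul_apply, one_mul, neg_add_cancel] at this
    rwa [this]
  have hcone := (inConeP_of_coeff_ne_zero (φ y).2 _ hne).1 hab.le
  simp only [Pi.add_apply, Pi.neg_apply, ψ'] at hcone
  linarith

theorem hibiTrace_eq_top_of_isGradedPoset (h : IsGradedPoset (Pbar P)) :
    hibiTrace k P = ⊤ := by
  obtain ⟨ρ, hρ⟩ := h
  let ψ : Pbar P → ℤ := fun c => ρ c - ρ ⊤
  have hψ0 : ψ ⊤ = 0 := sub_self _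
  have hψ1 : ∀ a b : Pbar P, a ⋖ b → ψ a = ψ b + 1 := fun a b hab => by
    simp only [ψ, hρ a b hab]
    ring
  have hmem : ∀ x ∈ hibiOmega k P, hibiMono k P (-ψ) * x ∈ hibiRing k P := by
    intro x hx
    induction hx using Submodule.span_induction with
    | mem x hx =>
      obtain ⟨ψ', h0, h1, rfl⟩ := hx
      have : hibiMono k P (-ψ) * hibiMono k P ψ' = hibiMono k P (-ψ + ψ') := by
        simp [hibiMono, AddMonoidAlgebra.single_mul_single]
      rw [this]
      refine hibiMono_mem_hibiRing ⟨antitone_of_forall_covBy fun a b hab => ?_, by simp [hψ0, h0]⟩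
      simp only [Pi.add_apply, Pi.neg_apply]
      linarith [h1 a b hab, hψ1 a b hab]
    | zero => simp
    | add x y _ _ hx hy => simpa [mul_add] using add_mem hx hy
    | smul r x _ hx =>
      have : hibiMono k P (-ψ) * r • x = (r : AddMonoidAlgebra k _) * (hibiMono k P (-ψ) * x) :=
        mul_left_comm _ _ _
      rw [this]
      exact mul_mem r.2 hx
  let φ : ↥(hibiOmega k P) →ₗ[↥(hibiRing k P)] ↥(hibiRing k P) :=
    { toFun := fun x => ⟨hibiMono k P (-ψ) * x, hmem x x.2⟩
      map_add' := fun x y => Subtype.ext (mul_add _ _ _)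
      map_smul' := fun r x => Subtype.ext (mul_left_comm _ _ _) }
  refine (Ideal.eq_top_iff_one _).2 (Ideal.subset_span ⟨φ, ⟨hibiMono k P ψ,
    Submodule.subset_span ⟨ψ, hψ0, fun a b hab => (hψ1 a b hab).ge, rfl⟩⟩, Subtype.ext ?_⟩)
  change hibiMono k P (-ψ) * hibiMono k P ψ = 1
  simp [hibiMono, AddMonoidAlgebra.single_mul_single, AddMonoidAlgebra.one_def]

end Hibi

/-- The trace ideal `tr(ω)` of the Hibi ring `R(P)` is the whole ring
(i.e. the non-Gorenstein locus of `Spec R(P)` is empty) iff the bounded poset `P̄` is graded. -/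
theorem hibi_trace_eq_top_iff_graded
    (k : Type) [Field k] [IsAlgClosed k] [CharZero k]
    (P : Type) [Fintype P] [PartialOrder P] :
    hibiTrace k P = ⊤ ↔ IsGradedPoset (Pbar P) := by
  exact ⟨isGradedPoset_of_hibiTrace_eq_top, hibiTrace_eq_top_of_isGradedPoset⟩
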